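/- For all integers m, n, t > 0 and all integers a, b with 0 ≤ b ≤ a ≤ n−t such that n − i + a − b ≠ 0 for every i ∈ {1,…,n−t+1}, the number of m-divisible small (m,t)-Schröder paths S of height n with dg(S) = a and cd(S) = b equals Σ_{i=1}^{n−t+1} ( (n−i)(n−i+a+1)/(n(n−i+a−b)) − m(n−t−i+1)/(mn−t+1) ) · C(n−i+a−b, a−b)·C(mn−t+1, n−t−i+1)·C(n, i−a−1), as an identity in ℚ. -/

import Mathlib

/-- A step of a lattice path: north `(0,1)`, east `(1,0)` or diagonal `(1,1)`. -/
inductive Step : Type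
  | N : Step
  | E : Step
  | D : Step
  deriving DecidableEq

/-- The displacement vector of a step. -/
def stepVec : Step → ℤ × ℤ
  | .N => (0, 1)
  | .E => (1, 0)
  | .D => (1, 1)

/-- The lattice point reached after the first `k` steps of the path `P` (starting at the
origin). -/
def pt (P : List Step) (k : ℕ) : ℤ × ℤ := ((P.take k).map stepVec).sum

/-- The path `P` starts with at least `t` north steps. -/
def StartsNorth (t : ℤ) (P : List Step) : Prop := List.replicate t.toNat Step.N <+: P

/-- The path `P` stays weakly above the line `x = m·y`. -/
def AboveLine (m : ℤ) (P : List Step) : Prop := ∀ k : ℕ, (pt P k).1 ≤ m * (pt P k).2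

/-- An `(m,t)`-Schröder path of height `n`: a lattice path from `(0,0)` to `(mn,n)` using
north, east and diagonal steps, starting with at least `t` north steps and never going
below the line `x = m·y`. -/
def IsSchroeder (m n t : ℤ) (P : List Step) : Prop :=
  StartsNorth t P ∧ pt P P.length = (m * n, n) ∧ AboveLine m P

/-- An `(m,t)`-Dyck path of height `n`: an `(m,t)`-Schröder path of height `n` with no
diagonal steps. -/
def IsDyck (m n t : ℤ) (P : List Step) : Prop :=
  IsSchroeder m n t P ∧ ∀ s ∈ P, s ≠ Step.D

/-- A Schröder path is small if none of its diagonal steps starts on the line `x = m·y`. -/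
def IsSmall (m : ℤ) (P : List Step) : Prop :=
  ∀ j : ℕ, P[j]? = some Step.D → (pt P j).1 ≠ m * (pt P j).2

/-- A Schröder path is positive if it touches the line `x = m·y` only at its two
endpoints. -/
def IsPositive (m : ℤ) (P : List Step) : Prop :=
  ∀ k : ℕ, 0 < k → k < P.length → (pt P k).1 ≠ m * (pt P k).2

/-- The set of indices `j` such that the `j`-th step of `P` is east and the `(j+1)`-st is
north; the corresponding valley point is `pt P (j+1)`. -/
def valleys (P : List Step) : Finset ℕ :=
  (Finset.range P.length).filter fun j => P[j]? = some Step.E ∧ P[j + 1]? = some Step.N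

/-- The number of valleys of `P`. -/
def val (P : List Step) : ℕ := (valleys P).card

/-- The number of valleys of `P` whose `x`-coordinate is congruent to `i` modulo `m`. -/
def ival (m i : ℤ) (P : List Step) : ℕ :=
  ((valleys P).filter fun j => (pt P (j + 1)).1 % m = i % m).card

/-- The set of returns of `P`: valleys of the form `(m·i, i)`. -/
def returns (m : ℤ) (P : List Step) : Finset ℕ :=
  (valleys P).filter fun j => (pt P (j + 1)).1 = m * (pt P (j + 1)).2

/-- The number of returns of `P`. -/
def ret (m : ℤ) (P : List Step) : ℕ := (returns m P).card

/-- The set of indices of diagonal steps of `P`. -/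
def diags (P : List Step) : Finset ℕ :=
  (Finset.range P.length).filter fun j => P[j]? = some Step.D

/-- The number of diagonal steps of `P`. -/
def dg (P : List Step) : ℕ := (diags P).card

/-- A Schröder path is `m`-divisible if every diagonal step ends at an `x`-coordinate
divisible by `m`. -/
def MDivisible (m : ℤ) (P : List Step) : Prop :=
  ∀ j ∈ diags P, m ∣ (pt P (j + 1)).1

/-- The number of cornered diagonal steps of `P`: diagonal steps connecting `(i·m − 1, i)`
to `(i·m, i + 1)` for some `i`. -/
def cd (m : ℤ) (P : List Step) : ℕ :=
  ((diags P).filter fun j => (pt P (j + 1)).1 = m * ((pt P (j + 1)).2 - 1)).card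

/-- The generalized binomial coefficient `C(p,q) = p(p−1)⋯(p−q+1)/q!` for integers `p` and
`q ≥ 0`, and `C(p,q) = 0` for `q < 0`. -/
def C (p q : ℤ) : ℤ :=
  if q < 0 then 0
  else if 0 ≤ p then (p.toNat.choose q.toNat : ℤ)
  else (-1) ^ q.toNat * ((q - p - 1).toNat.choose q.toNat : ℤ)

section GeneratingSeries

open PowerSeries

variable {R : Type*} [CommRing R]

/-- `1 + αu`, as a power series in `u`. -/
noncomputable def diagSeries (α : R) : PowerSeries R :=
  1 + PowerSeries.C α * X

/-- The series whose coefficient at `u^s` counts, with weight `α` for each non-cornered diagonal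
step, the paths with `b` cornered diagonal steps that start at
distance `(M + 1) * q + r + 1` to the west and `s` to the south of the endpoint; `Y` stands for
the inverse of `1 + αu`. -/
noncomputable def suffixSeries (α : R) (Y : PowerSeries R) (M b q r s : ℕ) :
    PowerSeries R :=
  X ^ b * Y ^ (b + 1) * (diagSeries α + X) ^ q * (1 + X) ^ (M * q + r + s) *
    ((1 + X) - ((M + 1 : ℕ) : PowerSeries R) * X * (diagSeries α + X))

variable {α : R} {Y : PowerSeries R}

lemma constantCoeff_diagSeries : constantCoeff (diagSeries α) = 1 := by
  simp [diagSeries]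

lemma constantCoeff_of_diagSeries_mul_eq_one (hY : diagSeries α * Y = 1) :
    constantCoeff Y = 1 := by
  have h := congrArg constantCoeff hY
  simpa [constantCoeff_diagSeries] using h

lemma coeff_zero_suffixSeries (hY : diagSeries α * Y = 1) (M b q r : ℕ) :
    coeff 0 (suffixSeries α Y M b q r 0) = if b = 0 then 1 else 0 := by
  rw [coeff_zero_eq_constantCoeff_apply]
  rcases Nat.eq_zero_or_pos b with rfl | hb
  · simp [suffixSeries, constantCoeff_diagSeries, constantCoeff_of_diagSeries_mul_eq_one hY]
  · simp [suffixSeries, hb.ne']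

lemma coeff_suffixSeries_succ_offset (M b q r s : ℕ) :
    coeff (s + 1) (suffixSeries α Y M b q (r + 1) (s + 1)) =
      coeff (s + 1) (suffixSeries α Y M b q r (s + 1)) +
        coeff s (suffixSeries α Y M b q (r + 1) s) := by
  rw [← coeff_succ_X_mul s (suffixSeries α Y M b q (r + 1) s), ← map_add]
  congr 1
  simp only [suffixSeries]
  ring

lemma coeff_suffixSeries_succ_block (M b q s : ℕ) :
    coeff (s + 1) (suffixSeries α Y M b (q + 1) 0 (s + 1)) =
      coeff (s + 1) (suffixSeries α Y M b q M (s + 1)) +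
        coeff s (suffixSeries α Y M b (q + 1) 0 s) +
        α * coeff s (suffixSeries α Y M b q M s) := by
  rw [← coeff_succ_X_mul s (suffixSeries α Y M b (q + 1) 0 s),
    ← coeff_C_mul, ← coeff_succ_X_mul s (PowerSeries.C _ * _), ← map_add, ← map_add]
  congr 1
  simp only [suffixSeries, diagSeries]
  ring

lemma coeff_suffixSeries_corner_succ (hY : diagSeries α * Y = 1) (M b s : ℕ) :
    coeff (s + 1) (suffixSeries α Y M (b + 1) (s + 1) 0 (s + 1)) =
      coeff s (suffixSeries α Y M (b + 1) s M s) +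
        coeff s (suffixSeries α Y M (b + 1) (s + 1) 0 s) +
        coeff s (suffixSeries α Y M b s M s) := by
  rw [← map_add, ← map_add, ← coeff_succ_X_mul s]
  congr 1
  simp only [suffixSeries]
  linear_combination (X ^ (b + 1) * Y ^ (b + 1) * (diagSeries α + X) ^ s *
    (1 + X) ^ (M * s + M + s) *
    ((1 + X) - ((M + 1 : ℕ) : PowerSeries R) * X * (diagSeries α + X))) * hY

lemma coeff_ballot_kernel [IsDomain R] [CharZero R] (α : R) (M s : ℕ) :
    coeff (s + 1) ((diagSeries α + X) ^ s * (1 + X) ^ (M * (s + 1) + s) *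
      ((1 + X) - ((M + 1 : ℕ) : PowerSeries R) * X * (diagSeries α + X))) = 0 := by
  set Ψ : PowerSeries R :=
    (diagSeries α + X) ^ (s + 1) * (1 + X) ^ (M * (s + 1) + s + 1) with hΨ
  have hd : d⁄dX R (diagSeries α + X) = PowerSeries.C α + 1 := by
    simp [diagSeries]
  have hd' : d⁄dX R (1 + X) = 1 := by
    simp
  have key : ((s + 1 : ℕ) : PowerSeries R) * Ψ - X * d⁄dX R Ψ =
      ((s + 1 : ℕ) : PowerSeries R) *
        ((diagSeries α + X) ^ s * (1 + X) ^ (M * (s + 1) + s) *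
      ((1 + X) - ((M + 1 : ℕ) : PowerSeries R) * X * (diagSeries α + X))) := by
    rw [hΨ, Derivation.leibniz, Derivation.leibniz_pow, Derivation.leibniz_pow, hd, hd']
    simp only [smul_eq_mul, nsmul_eq_mul, Nat.add_sub_cancel]
    simp only [diagSeries]
    push_cast
    ring
  have h := congrArg (coeff (s + 1)) key
  rw [map_sub, coeff_succ_X_mul, coeff_derivative] at h
  have hc : ∀ f : PowerSeries R,
      coeff (s + 1) (((s + 1 : ℕ) : PowerSeries R) * f) =
        ((s + 1 : ℕ) : R) * coeff (s + 1) f := by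
    intro f
    rw [← map_natCast (PowerSeries.C (R := R)), coeff_C_mul]
  rw [hc, hc] at h
  have h0 : ((s + 1 : ℕ) : R) ≠ 0 := by exact_mod_cast s.succ_ne_zero
  refine (mul_eq_zero.mp ?_).resolve_left h0
  rw [← h]
  push_cast
  ring

lemma coeff_suffixSeries_corner_zero [IsDomain R] [CharZero R] (hY : diagSeries α * Y = 1) (M s : ℕ) :
    coeff (s + 1) (suffixSeries α Y M 0 (s + 1) 0 (s + 1)) =
      coeff s (suffixSeries α Y M 0 s M s) + coeff s (suffixSeries α Y M 0 (s + 1) 0 s) := by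
  rw [← map_add, ← coeff_succ_X_mul s, ← sub_eq_zero, ← map_sub, ← coeff_ballot_kernel α M s]
  congr 1
  simp only [suffixSeries]
  linear_combination ((diagSeries α + X) ^ s * (1 + X) ^ (M * s + M + s) *
    ((1 + X) - ((M + 1 : ℕ) : PowerSeries R) * X * (diagSeries α + X))) * hY

end GeneratingSeries

section Paths

/-- `IsSuffix m P p s c b`: the steps `P` lead from the point at distance `p` to the west and `s`
to the south of the endpoint to that endpoint, as the remaining part of an `m`-divisible small
path, with `c` non-cornered and `b` cornered diagonal steps. -/
def IsSuffix (m : ℤ) : List Step → ℤ → ℤ → ℕ → ℕ → Prop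
  | [], p, s, c, b => p = 0 ∧ s = 0 ∧ c = 0 ∧ b = 0
  | .N :: P, p, s, c, b => IsSuffix m P p (s - 1) c b
  | .E :: P, p, s, c, b => m * s ≤ p - 1 ∧ IsSuffix m P (p - 1) s c b
  | .D :: P, p, s, c, b => m * s < p ∧ m ∣ p - 1 ∧
      if p - 1 = m * s then ∃ b', b = b' + 1 ∧ IsSuffix m P (p - 1) (s - 1) c b'
      else ∃ c', c = c' + 1 ∧ IsSuffix m P (p - 1) (s - 1) c' b

lemma not_isSuffix_of_neg {m : ℤ} : ∀ {P : List Step} {p s : ℤ} {c b : ℕ}, s < 0 →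
    ¬ IsSuffix m P p s c b
  | [], p, s, c, b, hs, h => by
    simp only [IsSuffix] at h
    omega
  | .N :: P, p, s, c, b, hs, h => not_isSuffix_of_neg (P := P) (by omega) h
  | .E :: P, p, s, c, b, hs, h => not_isSuffix_of_neg (P := P) hs h.2
  | .D :: P, p, s, c, b, hs, h => by
    obtain ⟨-, -, h⟩ := h
    split_ifs at h
    · obtain ⟨b', -, h⟩ := h
      exact not_isSuffix_of_neg (P := P) (by omega) h
    · obtain ⟨c', -, h⟩ := h
      exact not_isSuffix_of_neg (P := P) (by omega) h

lemma isSuffix_replicate_append {m : ℤ} (P : List Step) (p : ℤ) (c b : ℕ) :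
    ∀ (t : ℕ) (s : ℤ), IsSuffix m (List.replicate t Step.N ++ P) p s c b ↔
      IsSuffix m P p (s - t) c b
  | 0, s => by simp
  | t + 1, s => by
    rw [List.replicate_succ, List.cons_append]
    simp only [IsSuffix]
    rw [isSuffix_replicate_append P p c b t (s - 1)]
    rw [show s - 1 - (t : ℤ) = s - ((t + 1 : ℕ) : ℤ) by push_cast; ring]

/-- The number of cornered diagonal steps of `P` when it starts at `(x, y)`. -/
def cornerCount (m x y : ℤ) (P : List Step) : ℕ :=
  ((diags P).filter fun j => x + (pt P (j + 1)).1 = m * (y + (pt P (j + 1)).2 - 1)).card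

lemma pt_zero (P : List Step) : pt P 0 = 0 := by
  simp [pt]

lemma pt_cons_succ (σ : Step) (P : List Step) (k : ℕ) :
    pt (σ :: P) (k + 1) = stepVec σ + pt P k := by
  simp [pt]

lemma mem_diags {P : List Step} {j : ℕ} : j ∈ diags P ↔ P[j]? = some Step.D := by
  simp only [diags, Finset.mem_filter, Finset.mem_range, and_iff_right_iff_imp]
  intro h
  by_contra hj
  rw [List.getElem?_eq_none (by omega)] at h
  cases h

lemma dg_cons (σ : Step) (P : List Step) :
    dg (σ :: P) = dg P + if σ = Step.D then 1 else 0 := by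
  simp only [dg, diags, Finset.card_filter, List.length_cons, Finset.sum_range_succ',
    List.getElem?_cons_succ, List.getElem?_cons_zero, Option.some.injEq]

lemma cornerCount_cons (m x y : ℤ) (σ : Step) (P : List Step) :
    cornerCount m x y (σ :: P) =
      cornerCount m (x + (stepVec σ).1) (y + (stepVec σ).2) P +
        if σ = Step.D ∧ x + 1 = m * y then 1 else 0 := by
  simp only [cornerCount, diags, Finset.card_filter, Finset.filter_filter, List.length_cons,
    Finset.sum_range_succ', List.getElem?_cons_succ, pt_cons_succ, Prod.fst_add, Prod.snd_add,
    List.getElem?_cons_zero, pt_zero, add_assoc]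
  congr 1
  cases σ <;> simp [stepVec]

/-- `P`, started at `(x, y)`, is the remaining part of an `m`-divisible small path ending at
`(m * n, n)`. -/
def IsRemainder (m n x y : ℤ) (P : List Step) : Prop :=
  (x + (pt P P.length).1 = m * n ∧ y + (pt P P.length).2 = n) ∧
  (∀ k, x + (pt P k).1 ≤ m * (y + (pt P k).2)) ∧
  (∀ j, P[j]? = some Step.D → x + (pt P j).1 ≠ m * (y + (pt P j).2)) ∧
  (∀ j, P[j]? = some Step.D → m ∣ x + (pt P (j + 1)).1)

lemma isRemainder_cons (m n x y : ℤ) (σ : Step) (P : List Step) :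
    IsRemainder m n x y (σ :: P) ↔ x ≤ m * y ∧
      (σ = Step.D → x ≠ m * y ∧ m ∣ x + 1) ∧
      IsRemainder m n (x + (stepVec σ).1) (y + (stepVec σ).2) P := by
  have forall_nat : ∀ p : ℕ → Prop, (∀ k, p k) ↔ p 0 ∧ ∀ k, p (k + 1) := fun p =>
    ⟨fun h => ⟨h 0, fun k => h (k + 1)⟩, fun h k => by cases k; exacts [h.1, h.2 _]⟩
  simp only [IsRemainder]
  rw [forall_nat (fun k => x + (pt (σ :: P) k).1 ≤ _),
    forall_nat (fun j => (σ :: P)[j]? = some Step.D → x + (pt (σ :: P) j).1 ≠ _),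
    forall_nat (fun j => (σ :: P)[j]? = some Step.D → m ∣ x + (pt (σ :: P) (j + 1)).1)]
  simp only [List.length_cons, pt_cons_succ, pt_zero, List.getElem?_cons_succ]
  simp only [Prod.fst_add, Prod.snd_add, List.getElem?_cons_zero, add_assoc, Prod.fst_zero,
    Prod.snd_zero, add_zero, Option.some.injEq]
  cases σ <;> simp [stepVec] <;> tauto

lemma isRemainder_and_counts_iff (m n : ℤ) (hm : 0 < m) : ∀ (P : List Step) (x y : ℤ) (c b : ℕ),
    (IsRemainder m n x y P ∧ dg P = c + b ∧ cornerCount m x y P = b) ↔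
      (x ≤ m * y ∧ IsSuffix m P (m * n - x) (n - y) c b)
  | [], x, y, c, b => by
    have h1 : dg [] = 0 := rfl
    have h2 : cornerCount m x y [] = 0 := rfl
    simp only [IsRemainder, IsSuffix, h1, h2, pt, List.take_nil, List.map_nil, List.sum_nil,
      Prod.fst_zero, Prod.snd_zero, add_zero, List.getElem?_nil]
    constructor
    · rintro ⟨⟨⟨rfl, rfl⟩, h, -⟩, h3, h4⟩
      exact ⟨h 0, by omega, by omega, by omega, by omega⟩
    · rintro ⟨h, h1, h2, h3, h4⟩
      refine ⟨⟨⟨by omega, by omega⟩, fun _ => h, ?_, ?_⟩, by omega, by omega⟩ <;> simp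
  | .N :: P, x, y, c, b => by
    have ih := isRemainder_and_counts_iff m n hm P x (y + 1) c b
    rw [isRemainder_cons, dg_cons, cornerCount_cons]
    simp only [stepVec, IsSuffix, add_zero, reduceCtorEq, if_false, false_and, false_imp_iff,
      true_and, and_assoc] at ih ⊢
    rw [ih, show n - (y + 1) = n - y - 1 by ring]
    refine and_congr_right fun h => and_iff_right ?_
    nlinarith
  | .E :: P, x, y, c, b => by
    have ih := isRemainder_and_counts_iff m n hm P (x + 1) y c b
    rw [isRemainder_cons, dg_cons, cornerCount_cons]
    simp only [stepVec, IsSuffix, add_zero, reduceCtorEq, if_false, false_and, false_imp_iff,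
      true_and, and_assoc] at ih ⊢
    rw [ih, show m * n - (x + 1) = m * n - x - 1 by ring]
    refine and_congr_right fun h => and_congr_left fun _ => ?_
    rw [mul_sub]
    omega
  | .D :: P, x, y, c, b => by
    rw [isRemainder_cons, dg_cons, cornerCount_cons]
    simp only [stepVec, IsSuffix, if_true, true_and, forall_const]
    have hcorner : (m * n - x - 1 = m * (n - y)) ↔ (x + 1 = m * y) := by
      rw [mul_sub]; constructor <;> intro h <;> linarith
    simp only [hcorner]
    have hlt : x ≤ m * y → (m * (n - y) < m * n - x ↔ x ≠ m * y) := fun h => by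
      rw [mul_sub]; omega
    have hdvd : m ∣ m * n - x - 1 ↔ m ∣ x + 1 := by
      rw [sub_sub]; exact dvd_sub_right (dvd_mul_right m n)
    rw [hdvd]
    have e1 : m * n - (x + 1) = m * n - x - 1 := by ring
    have e2 : n - (y + 1) = n - y - 1 := by ring
    split_ifs with hc
    · constructor
      · rintro ⟨⟨h1, ⟨h2, h3⟩, h4⟩, h5, h6⟩
        obtain ⟨b', rfl⟩ : ∃ b', b = b' + 1 := ⟨_, h6.symm⟩
        have ih := (isRemainder_and_counts_iff m n hm P (x + 1) (y + 1) c b').1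
          ⟨h4, by omega, by omega⟩
        rw [e1, e2] at ih
        exact ⟨h1, (hlt h1).2 h2, h3, b', rfl, ih.2⟩
      · rintro ⟨h1, h2, h3, b', rfl, h4⟩
        rw [← e1, ← e2] at h4
        have ih := (isRemainder_and_counts_iff m n hm P (x + 1) (y + 1) c b').2
          ⟨by nlinarith, h4⟩
        exact ⟨⟨h1, ⟨(hlt h1).1 h2, h3⟩, ih.1⟩, by omega, by omega⟩
    · constructor
      · rintro ⟨⟨h1, ⟨h2, h3⟩, h4⟩, h5, h6⟩
        have hle : cornerCount m (x + 1) (y + 1) P ≤ dg P := Finset.card_filter_le _ _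
        obtain ⟨c', rfl⟩ : ∃ c', c = c' + 1 := ⟨c - 1, by omega⟩
        have ih := (isRemainder_and_counts_iff m n hm P (x + 1) (y + 1) c' b).1
          ⟨h4, by omega, by omega⟩
        rw [e1, e2] at ih
        exact ⟨h1, (hlt h1).2 h2, h3, c', rfl, ih.2⟩
      · rintro ⟨h1, h2, h3, c', rfl, h4⟩
        rw [← e1, ← e2] at h4
        have ih := (isRemainder_and_counts_iff m n hm P (x + 1) (y + 1) c' b).2
          ⟨by nlinarith [(hlt h1).1 h2], h4⟩
        exact ⟨⟨h1, ⟨(hlt h1).1 h2, h3⟩, ih.1⟩, by omega, by omega⟩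

lemma setOf_schroeder_eq_image (m n : ℤ) (t c b : ℕ) (hm : 0 < m) :
    {S : List Step | IsSchroeder m n t S ∧ IsSmall m S ∧ MDivisible m S ∧
        (dg S : ℤ) = (c + b : ℕ) ∧ (cd m S : ℤ) = b} =
      (List.replicate t Step.N ++ ·) '' {P | IsSuffix m P (m * n) (n - t) c b} := by
  ext S
  have h := isRemainder_and_counts_iff m n hm S 0 0 c b
  have hcd : cornerCount m 0 0 S = cd m S := by
    simp [cornerCount, cd]
  simp only [IsRemainder, hcd, zero_add, sub_zero, mul_zero, le_refl, true_and] at h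
  simp only [Set.mem_ofPred_eq, Set.mem_image, IsSchroeder, StartsNorth, AboveLine, IsSmall,
    MDivisible, mem_diags, Nat.cast_inj, Int.toNat_natCast, Prod.ext_iff]
  constructor
  · rintro ⟨⟨⟨P, rfl⟩, h1, h2⟩, h3, h4, h5, h6⟩
    exact ⟨P, (isSuffix_replicate_append P _ c b t n).1 (h.1 ⟨⟨h1, h2, h3, h4⟩, h5, h6⟩), rfl⟩
  · rintro ⟨P, hP, rfl⟩
    obtain ⟨⟨h1, h2, h3, h4⟩, h5, h6⟩ := h.2 ((isSuffix_replicate_append P _ c b t n).2 hP)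
    exact ⟨⟨⟨P, rfl⟩, h1, h2⟩, h3, h4, h5, h6⟩

end Paths

section Counting

/-- The set `S` is finite and its number of elements is the integer `z`. -/
def HasCard (S : Set (List Step)) (z : ℤ) : Prop :=
  ∃ w : ℕ, S.encard = w ∧ (w : ℤ) = z

lemma hasCard_empty : HasCard ∅ 0 := ⟨0, by simp, rfl⟩

lemma encard_eq_add_of_nil_notMem {S : Set (List Step)} (h : [] ∉ S) :
    S.encard = {P | Step.N :: P ∈ S}.encard + {P | Step.E :: P ∈ S}.encard +
      {P | Step.D :: P ∈ S}.encard := by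
  have hS : S = (List.cons Step.N '' {P | Step.N :: P ∈ S} ∪
      List.cons Step.E '' {P | Step.E :: P ∈ S}) ∪ List.cons Step.D '' {P | Step.D :: P ∈ S} := by
    ext P
    rcases P with _ | ⟨_ | _ | _, P⟩ <;> simp [h]
  have hinj : ∀ σ : Step, Function.Injective (List.cons σ) := fun σ => List.cons_injective
  conv_lhs => rw [hS]
  rw [Set.encard_union_eq, Set.encard_union_eq, (hinj _).encard_image, (hinj _).encard_image,
    (hinj _).encard_image]
  · rw [Set.disjoint_left]
    rintro _ ⟨P, -, rfl⟩ ⟨Q, -, hQ⟩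
    simp at hQ
  · rw [Set.disjoint_left]
    rintro _ (⟨P, -, rfl⟩ | ⟨P, -, rfl⟩) ⟨Q, -, hQ⟩ <;> simp at hQ

lemma hasCard_isSuffix_of_steps {m p s : ℤ} {c b : ℕ} {x y z : ℤ} (hp : p ≠ 0)
    (hN : HasCard {P | IsSuffix m P p (s - 1) c b} x)
    (hE : HasCard {P | IsSuffix m (Step.E :: P) p s c b} y)
    (hD : HasCard {P | IsSuffix m (Step.D :: P) p s c b} z) :
    HasCard {P | IsSuffix m P p s c b} (x + y + z) := by
  obtain ⟨u, hu, rfl⟩ := hN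
  obtain ⟨v, hv, rfl⟩ := hE
  obtain ⟨w, hw, rfl⟩ := hD
  refine ⟨u + v + w, ?_, by push_cast; ring⟩
  rw [encard_eq_add_of_nil_notMem (by simp [IsSuffix, hp])]
  push_cast
  rw [← hu, ← hv, ← hw]
  rfl

lemma hasCard_congr {p q : List Step → Prop} {z : ℤ} (h : HasCard {P | p P} z)
    (hpq : ∀ P, q P ↔ p P) : HasCard {P | q P} z := by
  rwa [show {P | q P} = {P | p P} from Set.ext hpq]

lemma hasCard_of_forall_not {q : List Step → Prop} (h : ∀ P, ¬ q P) : HasCard {P | q P} 0 := by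
  rw [show {P | q P} = ∅ from Set.eq_empty_of_forall_notMem h]
  exact hasCard_empty

lemma hasCard_isSuffix_zero_height {m : ℤ} (hm : 0 < m) (c b : ℕ) : ∀ p : ℕ,
    HasCard {P | IsSuffix m P p 0 c b} (if c = 0 ∧ b = 0 then 1 else 0)
  | 0 => by
    have key : ∀ P : List Step, IsSuffix m P (0 : ℕ) 0 c b ↔ P = [] ∧ c = 0 ∧ b = 0 := by
      rintro (_ | ⟨_ | _ | _, P⟩)
      · simp [IsSuffix]
      · simpa [IsSuffix] using not_isSuffix_of_neg (by norm_num)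
      · simp [IsSuffix]
      · simp [IsSuffix]
    split_ifs with h
    · refine ⟨1, ?_, rfl⟩
      rw [show {P | IsSuffix m P (0 : ℕ) 0 c b} = {[]} from
        Set.ext fun P => (key P).trans (by simp [h])]
      simp
    · exact hasCard_of_forall_not fun P hP => h ((key P).1 hP).2
  | p + 1 => by
    have h := hasCard_isSuffix_of_steps (m := m) (p := (p + 1 : ℕ)) (s := 0) (c := c) (b := b)
      (by omega) (hasCard_of_forall_not fun P => not_isSuffix_of_neg (by norm_num))
      (hasCard_congr (hasCard_isSuffix_zero_height hm c b p) fun P => by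
        simp [IsSuffix])
      (hasCard_of_forall_not fun P hP => by
        obtain ⟨-, -, hP⟩ := hP
        split_ifs at hP
        · obtain ⟨_, -, hP⟩ := hP
          exact not_isSuffix_of_neg (by norm_num) hP
        · obtain ⟨_, -, hP⟩ := hP
          exact not_isSuffix_of_neg (by norm_num) hP)
    simpa using h

/-- From a point on the line other than the endpoint, a path can only go north. -/
lemma hasCard_isSuffix_boundary {m s : ℤ} {c b : ℕ} {z : ℤ} (hs : m * s ≠ 0)
    (h : HasCard {P | IsSuffix m P (m * s) (s - 1) c b} z) :
    HasCard {P | IsSuffix m P (m * s) s c b} z := by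
  have h' := hasCard_isSuffix_of_steps hs h
    (hasCard_of_forall_not fun P hP => by have := hP.1; omega)
    (hasCard_of_forall_not fun P hP => by have := hP.1; omega)
  simpa using h'

open PowerSeries in
theorem hasCard_isSuffix {Y : PowerSeries (Polynomial ℤ)} (hY : diagSeries Polynomial.X * Y = 1)
    (M : ℕ) : ∀ s q r c b : ℕ, s ≤ q → r ≤ M →
      HasCard {P | IsSuffix ((M : ℤ) + 1) P (((M : ℤ) + 1) * q + r + 1) s c b}
        ((coeff s (suffixSeries Polynomial.X Y M b q r s)).coeff c) := by
  intro s
  have hm : (0 : ℤ) < (M : ℤ) + 1 := by positivity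
  induction s with
  | zero =>
    intro q r c b _ _
    rw [coeff_zero_suffixSeries hY]
    have h := hasCard_isSuffix_zero_height hm c b ((M + 1) * q + r + 1)
    push_cast at h ⊢
    convert h using 1
    by_cases hb : b = 0 <;> simp [hb, Polynomial.coeff_one]
  | succ s ihs =>
    have eN : ((s + 1 : ℕ) : ℤ) - 1 = s := by push_cast; ring
    intro q
    induction q with
    | zero => intro r c b h; omega
    | succ q ihq =>
      intro r c b hsq hr
      have hsq' : (s : ℤ) ≤ q := by omega
      induction r with
      | succ r ihr =>
        rw [coeff_suffixSeries_succ_offset, Polynomial.coeff_add]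
        have h := hasCard_isSuffix_of_steps
          (p := ((M : ℤ) + 1) * (q + 1 : ℕ) + (r + 1 : ℕ) + 1) (s := (s + 1 : ℕ))
          (m := (M : ℤ) + 1) (by positivity)
          (by rw [eN]; exact ihs (q + 1) (r + 1) c b (by omega) hr)
          (hasCard_congr (ihr (by omega)) fun P => by
            simp only [IsSuffix]
            rw [show ((M : ℤ) + 1) * (q + 1 : ℕ) + (r + 1 : ℕ) + 1 - 1 =
              ((M : ℤ) + 1) * (q + 1 : ℕ) + r + 1 by push_cast; ring]
            refine and_iff_right ?_
            push_cast
            nlinarith)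
          (hasCard_of_forall_not fun P hP => by
            have h1 := hP.2.1
            rw [add_sub_cancel_right, dvd_add_right (dvd_mul_right _ _)] at h1
            have := Int.le_of_dvd (by positivity) h1
            omega)
        convert h using 1
        ring
      | zero =>
        have eE : ((M : ℤ) + 1) * (q + 1 : ℕ) + (0 : ℕ) + 1 - 1 = ((M : ℤ) + 1) * q + M + 1 := by
          push_cast; ring
        have hdvd : (M : ℤ) + 1 ∣ ((M : ℤ) + 1) * q + M + 1 :=
          ⟨q + 1, by ring⟩
        have hN := ihs (q + 1) 0 c b (by omega) (by omega)
        rcases hsq.lt_or_eq with hlt | heq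
        · have hlt' : (s : ℤ) + 1 ≤ q := by omega
          have hE := ihq M c b (by omega) le_rfl
          have hlt2 : ((M : ℤ) + 1) * (s + 1 : ℕ) < ((M : ℤ) + 1) * q + M + 1 := by
            push_cast
            nlinarith
          have hD : HasCard {P | IsSuffix ((M : ℤ) + 1) (Step.D :: P)
              (((M : ℤ) + 1) * (q + 1 : ℕ) + (0 : ℕ) + 1) (s + 1 : ℕ) c b}
              ((Polynomial.X * coeff s (suffixSeries Polynomial.X Y M b q M s)).coeff c) := by
            simp only [IsSuffix, eE, eN, hlt2.ne', if_false]
            rcases c with _ | c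
            · rw [Polynomial.coeff_X_mul_zero]
              exact hasCard_of_forall_not fun P hP => by
                obtain ⟨-, -, c', hc, -⟩ := hP
                omega
            · rw [Polynomial.coeff_X_mul]
              refine hasCard_congr (ihs q M c b (by omega) le_rfl) fun P => ?_
              constructor
              · rintro ⟨-, -, c', hc, hP⟩
                obtain rfl : c = c' := by omega
                exact hP
              · intro hP
                exact ⟨by rw [← sub_lt_zero]; push_cast at hlt2 ⊢; nlinarith, hdvd, c, rfl, hP⟩
          have h := hasCard_isSuffix_of_steps
            (p := ((M : ℤ) + 1) * (q + 1 : ℕ) + (0 : ℕ) + 1) (s := (s + 1 : ℕ))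
            (by positivity) (by rw [eN]; exact hN)
            (hasCard_congr hE fun P => by
              simp only [IsSuffix]
              rw [eE]
              exact and_iff_right hlt2.le) hD
          rw [coeff_suffixSeries_succ_block, Polynomial.coeff_add, Polynomial.coeff_add]
          convert h using 1
          ring
        · obtain rfl : s = q := by omega
          have eB : ((M : ℤ) + 1) * s + M + 1 = ((M : ℤ) + 1) * (s + 1 : ℕ) := by
            push_cast; ring
          have hprev := fun b => ihs s M c b le_rfl le_rfl
          rw [eB] at eE hdvd
          simp only [eB] at hprev
          have hE := hasCard_isSuffix_boundary (s := (s + 1 : ℕ)) (by positivity)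
            (by rw [eN]; exact hprev b)
          have hD : HasCard {P | IsSuffix ((M : ℤ) + 1) (Step.D :: P)
              (((M : ℤ) + 1) * (s + 1 : ℕ) + (0 : ℕ) + 1) (s + 1 : ℕ) c b}
              (if b = 0 then 0 else
                (coeff s (suffixSeries Polynomial.X Y M (b - 1) s M s)).coeff c) := by
            simp only [IsSuffix, eE, eN, if_true]
            rcases b with _ | b
            · exact hasCard_of_forall_not fun P hP => by
                obtain ⟨-, -, b', hb, -⟩ := hP
                omega
            · refine hasCard_congr (hprev b) fun P => ?_
              constructor
              · rintro ⟨-, -, b', hb, hP⟩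
                obtain rfl : b = b' := by omega
                exact hP
              · intro hP
                exact ⟨by omega, hdvd, b, rfl, hP⟩
          have h := hasCard_isSuffix_of_steps
            (p := ((M : ℤ) + 1) * (s + 1 : ℕ) + (0 : ℕ) + 1) (s := (s + 1 : ℕ))
            (by positivity) (by rw [eN]; exact hN)
            (hasCard_congr hE fun P => by
              simp only [IsSuffix]
              rw [eE]
              exact and_iff_right le_rfl) hD
          rcases b with _ | b
          · rw [coeff_suffixSeries_corner_zero hY, Polynomial.coeff_add]
            convert h using 1
            simp only [if_true]
            ring
          · rw [coeff_suffixSeries_corner_succ hY, Polynomial.coeff_add, Polynomial.coeff_add]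
            convert h using 1
            simp only [Nat.succ_ne_zero, if_false, Nat.add_sub_cancel]
            ring

end Counting

section Extraction

open PowerSeries

/-- The ring homomorphism sending `g(u)` to `g(αu)`. -/
noncomputable def scaleVar : PowerSeries ℤ →+* PowerSeries (Polynomial ℤ) :=
  (rescale (Polynomial.X : Polynomial ℤ)).comp (PowerSeries.map Polynomial.C)

lemma coeff_scaleVar (g : PowerSeries ℤ) (k : ℕ) :
    coeff k (scaleVar g) = Polynomial.X ^ k * Polynomial.C (coeff k g) := by
  simp [scaleVar, coeff_rescale]

lemma scaleVar_one_add_X : scaleVar (1 + X) = diagSeries Polynomial.X := by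
  ext1 k
  rw [coeff_scaleVar]
  simp only [diagSeries, map_add, coeff_one, coeff_X, coeff_C_mul]
  rcases k with _ | _ | k <;> simp

lemma coeff_coeff_map_mul_scaleVar (h g : PowerSeries ℤ) (s c : ℕ) :
    (coeff s (PowerSeries.map Polynomial.C h * scaleVar g)).coeff c =
      if c ≤ s then coeff (s - c) h * coeff c g else 0 := by
  have hterm : ∀ ij : ℕ × ℕ, (coeff ij.1 (PowerSeries.map Polynomial.C h) *
      coeff ij.2 (scaleVar g)).coeff c =
        if c = ij.2 then coeff ij.1 h * coeff ij.2 g else 0 := by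
    intro ij
    rw [coeff_scaleVar, coeff_map, mul_left_comm, ← Polynomial.C_mul, Polynomial.coeff_X_pow_mul',
      Polynomial.coeff_C]
    by_cases h1 : c = ij.2
    · simp [h1]
    · rw [if_neg h1]
      split_ifs <;> first | rfl | omega
  rw [coeff_mul, Polynomial.finsetSum_coeff, Finset.sum_congr rfl fun ij _ => hterm ij]
  split_ifs with hc
  · rw [Finset.sum_eq_single (s - c, c)]
    · simp
    · rintro ⟨i, j⟩ hij hne
      rw [Finset.HasAntidiagonal.mem_antidiagonal] at hij
      refine if_neg ?_
      rintro rfl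
      exact hne (Prod.ext (by simp only at hij ⊢; omega) rfl)
    · intro h1
      simp only [Finset.HasAntidiagonal.mem_antidiagonal] at h1
      omega
  · refine Finset.sum_eq_zero fun ij hij => if_neg ?_
    rw [Finset.HasAntidiagonal.mem_antidiagonal] at hij
    omega

lemma coeff_one_add_X_pow (K l : ℕ) : coeff l ((1 + X : PowerSeries ℤ) ^ K) = K.choose l := by
  have h : (1 + X : PowerSeries ℤ) ^ K = (((1 + Polynomial.X) ^ K : Polynomial ℤ) : ℤ⟦X⟧) := by
    simp
  rw [h, Polynomial.coeff_coe, Polynomial.coeff_one_add_X_pow]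

lemma coeff_coeff_X_pow_mul_scaleVar (g : PowerSeries ℤ) (d K s c : ℕ) :
    (coeff s (X ^ d * (1 + X) ^ K * scaleVar g)).coeff c =
      if d + c ≤ s then (K.choose (s - d - c) : ℤ) * coeff c g else 0 := by
  have h : (X ^ d * (1 + X) ^ K : PowerSeries (Polynomial ℤ)) =
      PowerSeries.map Polynomial.C (X ^ d * (1 + X) ^ K) := by simp
  rw [h, coeff_coeff_map_mul_scaleVar, coeff_X_pow_mul', coeff_one_add_X_pow]
  by_cases h1 : d + c ≤ s
  · rw [if_pos h1, if_pos (by omega), if_pos (by omega), Nat.sub_right_comm]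
  · rw [if_neg h1]
    split_ifs
    · omega
    · simp
    · rfl

variable {Z : PowerSeries ℤ}

lemma coeff_one_add_X_pow_mul_inv_pow (hZ : (1 + X) * Z = 1) {d e : ℕ} (hde : d ≤ e) (c : ℕ) :
    coeff c ((1 + X : PowerSeries ℤ) ^ e * Z ^ d) = ((e - d).choose c : ℤ) := by
  obtain ⟨f, rfl⟩ := Nat.exists_eq_add_of_le hde
  rw [Nat.add_sub_cancel_left, ← coeff_one_add_X_pow, pow_add, mul_right_comm, ← mul_pow, hZ,
    one_pow, one_mul]

lemma coeff_coeff_expand (s c j d N K : ℕ) :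
    (coeff s (X ^ j * scaleVar Z ^ d * (diagSeries Polynomial.X + X) ^ N * (1 + X) ^ K)).coeff c =
      ∑ k ∈ Finset.range (N + 1), (N.choose k : ℤ) * (if j + k + c ≤ s then
        (K.choose (s - (j + k) - c) : ℤ) * coeff c ((1 + X) ^ (N - k) * Z ^ d) else 0) := by
  have h : (X ^ j * scaleVar Z ^ d * (diagSeries Polynomial.X + X) ^ N * (1 + X) ^ K) =
      ∑ k ∈ Finset.range (N + 1), N.choose k •
        (X ^ (j + k) * (1 + X) ^ K * scaleVar ((1 + X) ^ (N - k) * Z ^ d)) := by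
    rw [add_comm (diagSeries _), add_pow, Finset.mul_sum, Finset.sum_mul]
    refine Finset.sum_congr rfl fun k _ => ?_
    rw [map_mul, map_pow, map_pow, scaleVar_one_add_X, nsmul_eq_mul]
    ring
  rw [h, map_sum, Polynomial.finsetSum_coeff]
  refine Finset.sum_congr rfl fun k _ => ?_
  rw [map_nsmul, Polynomial.coeff_smul, coeff_coeff_X_pow_mul_scaleVar, nsmul_eq_mul]

lemma coeff_coeff_suffixSeries (M b q r s c : ℕ) :
    (coeff s (suffixSeries Polynomial.X (scaleVar Z) M b q r s)).coeff c =
      (∑ k ∈ Finset.range (q + 1), (q.choose k : ℤ) * (if b + k + c ≤ s then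
        ((M * q + r + s + 1).choose (s - (b + k) - c) : ℤ) *
          coeff c ((1 + X) ^ (q - k) * Z ^ (b + 1)) else 0)) -
      (M + 1) * ∑ k ∈ Finset.range (q + 1 + 1), ((q + 1).choose k : ℤ) *
        (if b + 1 + k + c ≤ s then ((M * q + r + s).choose (s - (b + 1 + k) - c) : ℤ) *
          coeff c ((1 + X) ^ (q + 1 - k) * Z ^ (b + 1)) else 0) := by
  rw [← coeff_coeff_expand, ← coeff_coeff_expand]
  have h : suffixSeries Polynomial.X (scaleVar Z) M b q r s =
      X ^ b * scaleVar Z ^ (b + 1) * (diagSeries Polynomial.X + X) ^ q *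
        (1 + X) ^ (M * q + r + s + 1) -
      (M + 1) • (X ^ (b + 1) * scaleVar Z ^ (b + 1) * (diagSeries Polynomial.X + X) ^ (q + 1) *
        (1 + X) ^ (M * q + r + s)) := by
    rw [suffixSeries, nsmul_eq_mul]
    ring
  rw [h, map_sub, Polynomial.coeff_sub, map_nsmul, Polynomial.coeff_smul, nsmul_eq_mul]
  push_cast
  ring

lemma exists_one_add_X_mul_eq_one : ∃ Z : PowerSeries ℤ, (1 + X) * Z = 1 := by
  have h : IsUnit (1 + X : PowerSeries ℤ) := by
    rw [PowerSeries.isUnit_iff_constantCoeff]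
    simp
  exact h.exists_right_inv

lemma scaleVar_inv (hZ : (1 + X) * Z = 1) : diagSeries Polynomial.X * scaleVar Z = 1 := by
  rw [← scaleVar_one_add_X, ← map_mul, hZ, map_one]

end Extraction

section Summation

lemma summand_eq {q k b c d : ℕ} (K l M : ℕ) (hq : q = k + b + c + d) (hcd : c + d ≠ 0) :
    (q.choose k * ((K + 1).choose l * (c + d - 1).choose c) : ℚ) -
        (M + 1) * ((q + 1).choose k *
          ((if 1 ≤ l then (K.choose (l - 1) : ℚ) else 0) * (c + d).choose c)) =
      (d * (d + c + b + 1) / ((q + 1) * (c + d)) - (M + 1) * l / (K + 1)) *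
        (c + d).choose c * (K + 1).choose l * (q + 1).choose k := by
  obtain ⟨e, he⟩ := Nat.exists_eq_succ_of_ne_zero hcd
  have h1 : (q.choose k : ℚ) * (q + 1) = (q + 1).choose k * (d + c + b + 1) := by
    have h := Nat.choose_mul_succ_eq q k
    rw [show q + 1 - k = d + c + b + 1 by omega] at h
    exact_mod_cast h
  have h2 : ((c + d - 1).choose c : ℚ) * (c + d) = (c + d).choose c * d := by
    have h := Nat.choose_mul_succ_eq e c
    rw [show e + 1 - c = d by omega, show e + 1 = c + d by omega] at h
    rw [show c + d - 1 = e by omega]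
    exact_mod_cast h
  have h3 : (if 1 ≤ l then (K.choose (l - 1) : ℚ) else 0) * (K + 1) = (K + 1).choose l * l := by
    rcases l with _ | l
    · simp
    · have h := Nat.add_one_mul_choose_eq K l
      rw [if_pos (by omega), Nat.add_sub_cancel, mul_comm]
      exact_mod_cast h
  have hq0 : (q + 1 : ℚ) ≠ 0 := by positivity
  have hK0 : (K + 1 : ℚ) ≠ 0 := by positivity
  have hcd0 : (c + d : ℚ) ≠ 0 := by exact_mod_cast hcd
  rw [← eq_div_iff hq0] at h1
  rw [← eq_div_iff hcd0] at h2
  rw [← eq_div_iff hK0] at h3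
  rw [h1, h2, h3]
  field_simp

lemma C_natCast (p q : ℕ) : C (p : ℤ) q = p.choose q := by
  simp [C]

lemma C_of_neg {p q : ℤ} (hq : q < 0) : C p q = 0 := by
  simp [C, hq]

lemma sum_Icc_eq_sum_range {a L : ℕ} (f : ℤ → ℚ) (hf : ∀ i : ℤ, i ≤ a → f i = 0) :
    ∑ i ∈ Finset.Icc (1 : ℤ) ((a + L : ℕ) : ℤ), f i = ∑ k ∈ Finset.range L, f ((a + 1 + k : ℕ)) := by
  rw [← Finset.sum_image (f := f) (g := fun k : ℕ => ((a + 1 + k : ℕ) : ℤ))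
    (fun x _ y _ h => by simpa using h)]
  symm
  refine Finset.sum_subset ?_ ?_
  · intro i hi
    simp only [Finset.mem_image, Finset.mem_range, Finset.mem_Icc] at hi ⊢
    omega
  · intro i hi hi'
    refine hf i ?_
    by_contra hlt
    refine hi' (Finset.mem_image.2 ⟨(i - a - 1).toNat, ?_, ?_⟩)
    · rw [Finset.mem_Icc] at hi
      rw [Finset.mem_range]
      omega
    · push_cast
      omega

end Summation

/-- the number of `m`-divisible small `(m,t)`-Schröder paths of height `n`
with `a` diagonal steps and `b` cornered diagonal steps. -/
theorem statement7 (m n t a b : ℤ) (hm : 0 < m) (hn : 0 < n) (ht : 0 < t)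
    (hb : 0 ≤ b) (hba : b ≤ a) (ha : a ≤ n - t)
    (hne : ∀ i ∈ Finset.Icc (1 : ℤ) (n - t + 1), n - i + a - b ≠ 0) :
    (({S : List Step | IsSchroeder m n t S ∧ IsSmall m S ∧ MDivisible m S ∧
        (dg S : ℤ) = a ∧ (cd m S : ℤ) = b}.ncard : ℚ))
      = ∑ i ∈ Finset.Icc (1 : ℤ) (n - t + 1),
          ((((n - i) * (n - i + a + 1) : ℤ) : ℚ) / (((n * (n - i + a - b) : ℤ)) : ℚ)
            - ((m * (n - t - i + 1) : ℤ) : ℚ) / ((m * n - t + 1 : ℤ) : ℚ))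
          * ((C (n - i + a - b) (a - b) : ℤ) : ℚ)
          * ((C (m * n - t + 1) (n - t - i + 1) : ℤ) : ℚ)
          * ((C n (i - a - 1) : ℤ) : ℚ) := by

  obtain ⟨M, rfl⟩ : ∃ M : ℕ, m = (M : ℤ) + 1 := ⟨(m - 1).toNat, by omega⟩
  obtain ⟨b, rfl⟩ := Int.eq_ofNat_of_zero_le hb
  obtain ⟨c, rfl⟩ : ∃ c : ℕ, a = (c + b : ℕ) := ⟨(a - b).toNat, by omega⟩
  obtain ⟨t, rfl⟩ := Int.eq_ofNat_of_zero_le ht.le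
  obtain ⟨L, hL⟩ : ∃ L : ℕ, n - t = ((c + b + L : ℕ) : ℤ) := ⟨(n - t - (c + b : ℕ)).toNat, by omega⟩
  obtain ⟨q, rfl⟩ : ∃ q : ℕ, n = (q : ℤ) + 1 := ⟨(n - 1).toNat, by omega⟩
  set s := c + b + L with hs
  have hsq : s ≤ q := by omega
  obtain ⟨Z, hZ⟩ := exists_one_add_X_mul_eq_one
  obtain ⟨w, hw, hwz⟩ := hasCard_isSuffix (scaleVar_inv hZ) M s q M c b hsq le_rfl
  rw [setOf_schroeder_eq_image _ _ _ _ _ hm,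
    Set.ncard_image_of_injective _ (List.append_right_injective _), hL,
    show ((M : ℤ) + 1) * (q + 1) = (M + 1) * q + M + 1 by ring, Set.ncard, hw, ENat.toNat_natCast]
  rw [← Int.cast_natCast, hwz, coeff_coeff_suffixSeries]
  have hK : ((M : ℤ) + 1) * q + M + 1 - t = (M * q + M + s : ℕ) := by
    push_cast
    linear_combination hL
  rw [hK, show ((s : ℤ) + 1) = ((c + b + (L + 1) : ℕ) : ℤ) by omega, sum_Icc_eq_sum_range]
  · have hrange : ∀ N ≥ q, Finset.range (L + 1) ⊆ Finset.range (N + 1) := fun N hN =>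
      Finset.range_mono (by omega)
    rw [← Finset.sum_subset (hrange q le_rfl) fun k _ hk => by
        rw [Finset.mem_range] at hk
        rw [if_neg (by omega), mul_zero],
      ← Finset.sum_subset (hrange (q + 1) (by omega)) fun k _ hk => by
        rw [Finset.mem_range] at hk
        rw [if_neg (by omega), mul_zero]]
    rw [Finset.mul_sum, ← Finset.sum_sub_distrib, Int.cast_sum]
    refine Finset.sum_congr rfl fun k hk => ?_
    rw [Finset.mem_range] at hk
    obtain ⟨d, hd⟩ : ∃ d, q = k + b + c + d := ⟨q - (k + b + c), by omega⟩
    obtain ⟨l, rfl⟩ : ∃ l, L = k + l := ⟨L - k, by omega⟩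
    have hcd : c + d ≠ 0 := by
      have h := hne (c + b + 1 + k : ℕ) (Finset.mem_Icc.2 ⟨by omega, by omega⟩)
      intro h0
      exact h (by omega)
    rw [if_pos (by omega), coeff_one_add_X_pow_mul_inv_pow hZ (by omega),
      coeff_one_add_X_pow_mul_inv_pow hZ (by omega),
      show q - k - (b + 1) = c + d - 1 by omega, show q + 1 - k - (b + 1) = c + d by omega,
      show s - (b + k) - c = l by omega, show s - (b + 1 + k) - c = l - 1 by omega,
      show ((q : ℤ) + 1 - (c + b + 1 + k : ℕ) + (c + b : ℕ) - b) = (c + d : ℕ) by omega,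
      show ((c + b : ℕ) - b : ℤ) = (c : ℕ) by omega,
      show ((q : ℤ) + 1 - (c + b + 1 + k : ℕ)) = (d : ℕ) by omega,
      show ((M * q + M + s : ℕ) + 1 : ℤ) = (M * q + M + s + 1 : ℕ) by push_cast; ring,
      show ((s : ℤ) - (c + b + 1 + k : ℕ) + 1) = (l : ℕ) by omega,
      show (((c + b + 1 + k : ℕ) : ℤ) - (c + b : ℕ) - 1) = (k : ℕ) by omega,
      show ((q : ℤ) + 1) = (q + 1 : ℕ) by omega,
      C_natCast, C_natCast, C_natCast]
    have h := summand_eq (M * q + M + s) l M hd hcd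
    have hif : b + 1 + k + c ≤ s ↔ 1 ≤ l := by omega
    simp only [hif]
    push_cast at h ⊢
    rw [← add_assoc (d : ℚ) c b]
    rw [← h]
    split_ifs <;> ring
  · intro i hi
    rw [C_of_neg (q := i - _ - 1) (by omega)]
    simp
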